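/- Let X ⊆ Fin n be a set of intervened variables and fix values x_i ∈ α i for each i ∈ X. Then the sum, over all full assignments v : ∀ i ∈ Fin n, α i that agree with x on X, of the truncated product ∏_{i ∉ X} P_i( v i, v restricted to PA i ), equals 1. In particular (taking X = ∅), the full factored product ∏_{i} P_i( v i, v restricted to PA i ) sums to 1 over all full assignments v; that is, the truncation formula defining the interventional distribution P(V \ X | do(X = x)) yields a probability distribution. -/

import Mathlib

/-! STATEMENT 11: the truncation formula yields a probability distribution: for an
intervention set X with fixed values x, the sum over all full assignments agreeing
with x on X of the truncated product ∏_{i ∉ X} P_i(v i, v restricted to PA i)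
equals 1 (the case X = ∅ being the full factored product). -/

open Finset
open scoped NNReal

/-- Restriction of a full assignment to the variables in `S`. -/
def restrictTo {n : ℕ} {α : Fin n → Type*} (S : Finset (Fin n)) (v : ∀ i, α i) :
    ∀ i : S, α i := fun i => v i

/-- A sequential product of factors sums to one: if `f i` depends only on the coordinates `j ≤ i`
and sums to one over the `i`-th coordinate, then `∏ i, f i` sums to one over all assignments. -/
theorem sum_prod_eq_one_of_sequential {R : Type*} [CommSemiring R] {n : ℕ} {α : Fin n → Type*}
    [∀ i, Fintype (α i)] [∀ i, Nonempty (α i)] (f : Fin n → (∀ i, α i) → R)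
    (hdep : ∀ i v w, (∀ j ≤ i, v j = w j) → f i v = f i w)
    (hsum : ∀ i v, ∑ a, f i (Function.update v i a) = 1) :
    ∑ v, ∏ i, f i v = 1 := by
  induction n with
  | zero => simp
  | succ n ih =>
    have tail_sum (a : α 0) :
        ∑ w : ∀ i : Fin n, α i.succ, ∏ i : Fin n, f i.succ (Fin.cons a w) = 1 := by
      refine ih (fun i w => f i.succ (Fin.cons a w)) (fun i v w h => ?_) (fun i v => ?_)
      · refine hdep _ _ _ fun j hj => ?_
        cases j using Fin.cases with
        | zero => rfl
        | succ j => simpa using h j (Fin.succ_le_succ_iff.mp hj)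
      · simp only [Fin.cons_update]
        exact hsum i.succ _
    let v₀ : ∀ i, α i := fun _ => Classical.arbitrary _
    have head_eq (a : α 0) (w : ∀ i : Fin n, α i.succ) :
        f 0 (Fin.cons a w) = f 0 (Function.update v₀ 0 a) := by
      refine hdep _ _ _ fun j hj => ?_
      obtain rfl : j = 0 := Fin.le_zero_iff.mp hj
      simp
    rw [← (Fin.consEquiv α).sum_comp, Fintype.sum_prod_type, ← hsum 0 v₀]
    refine Finset.sum_congr rfl fun a _ => ?_
    simp only [Fin.consEquiv, Equiv.coe_fn_mk, Fin.prod_univ_succ, head_eq, ← Finset.mul_sum,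
      tail_sum, mul_one]

theorem truncation_formula_sums_to_one (n : ℕ) (α : Fin n → Type*)
    [∀ i, Fintype (α i)] [∀ i, DecidableEq (α i)] [∀ i, Nonempty (α i)]
    (PA : Fin n → Finset (Fin n)) (hPA : ∀ i, ∀ j ∈ PA i, j < i)
    (P : ∀ i : Fin n, α i → (∀ j : PA i, α j) → ℝ≥0)
    (hP : ∀ (i : Fin n) (pa : ∀ j : PA i, α j), ∑ x : α i, P i x pa = 1)
    (X : Finset (Fin n)) (x : ∀ i : X, α i) :
    ∑ v ∈ Finset.univ.filter (fun v : ∀ i, α i => restrictTo X v = x),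
      ∏ i ∈ Xᶜ, P i (v i) (restrictTo (PA i) v) = 1 := by
  let f : Fin n → (∀ i, α i) → ℝ≥0 := fun i v =>
    if h : i ∈ X then if v i = x ⟨i, h⟩ then 1 else 0 else P i (v i) (restrictTo (PA i) v)
  have hdep (i : Fin n) (v w : ∀ i, α i) (h : ∀ j ≤ i, v j = w j) : f i v = f i w := by
    have hr : restrictTo (PA i) v = restrictTo (PA i) w :=
      funext fun j => h j (hPA i j j.2).le
    simp only [f, h i le_rfl, hr]
  have hsum (i : Fin n) (v : ∀ i, α i) : ∑ a, f i (Function.update v i a) = 1 := by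
    by_cases hi : i ∈ X
    · simp [f, hi]
    · have hr (a : α i) : restrictTo (PA i) (Function.update v i a) = restrictTo (PA i) v :=
        funext fun j => Function.update_of_ne (hPA i j j.2).ne _ _
      simp [f, hi, hr, hP]
  rw [← sum_prod_eq_one_of_sequential f hdep hsum, Finset.sum_filter]
  refine Finset.sum_congr rfl fun v _ => ?_
  split_ifs with hv
  · rw [← Finset.prod_mul_prod_compl X, Finset.prod_eq_one (s := X), one_mul]
    · exact Finset.prod_congr rfl fun i hi => by simp [f, Finset.mem_compl.mp hi]
    · intro i hi
      have : v i = x ⟨i, hi⟩ := congrFun hv ⟨i, hi⟩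
      simp [f, hi, this]
  · obtain ⟨⟨i, hi⟩, hne⟩ := Function.ne_iff.mp hv
    have hne' : v i ≠ x ⟨i, hi⟩ := hne
    exact (Finset.prod_eq_zero (Finset.mem_univ i) (by simp [f, hi, hne'])).symm
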